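/- arXiv:2408.09245 — 2 statements merged into one kernel-verified Lean document; each statement's English description precedes it below -/
import Mathlib

section
/- Fix matrices H_g ∈ ℝ^{n_f × n_g}, H_d ∈ ℝ^{n_f × n_d}, H_w ∈ ℝ^{n_f × n_w}, vectors d ∈ ℝ^{n_d}, ŵ ∈ ℝ^{n_w}, and bounds f̲, f̄ ∈ ℝ^{n_f}, g̲, ḡ ∈ ℝ^{n_g}, R_d, R_u ∈ ℝ^{n_g}. For a decision pair (g, η) ∈ ℝ^{n_g} × ℝ^{n_g} and a scenario w̃ ∈ ℝ^{n_w}, say that (g, η) satisfies the scenario constraints for w̃ if: f̲ ≤ H_g (g − (1ᵀ w̃) η) − H_d d + H_w (ŵ + w̃) ≤ f̄, g̲ ≤ g − (1ᵀ w̃) η ≤ ḡ, and R_d ≤ −(1ᵀ w̃) η ≤ R_u, all componentwise, where 1ᵀ w̃ denotes the sum of the entries of w̃. Let S = {w̃_1, ..., w̃_N} ⊆ ℝ^{n_w} be a finite scenario set and let V = {w̃_{i_1}, ..., w̃_{i_v}} ⊆ S satisfy S ⊆ convexHull ℝ V. Then the set of pairs (g, η) satisfying the scenario constraints for every w̃ ∈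 S equals the set of pairs (g, η) satisfying the scenario constraints for every w̃ ∈ V. -/
open Matrix

/-- The scenario constraints of the chance-constrained SCED problem for a decision pair
`(g, η)` and a wind forecasting error scenario `wt`: line flow limits, generation capacity
limits and ramp rate limits, all componentwise.  Here `1ᵀ wt = ∑ i, wt i`. -/
def SCEDSat {nf ng nd nw : ℕ}
    (Hg : Matrix (Fin nf) (Fin ng) ℝ) (Hd : Matrix (Fin nf) (Fin nd) ℝ)
    (Hw : Matrix (Fin nf) (Fin nw) ℝ)
    (d : Fin nd → ℝ) (wHat : Fin nw → ℝ)
    (fLo fHi : Fin nf → ℝ) (gLo gHi : Fin ng → ℝ) (Rd Ru : Fin ng → ℝ)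
    (g η : Fin ng → ℝ) (wt : Fin nw → ℝ) : Prop :=
  (fLo ≤ Hg.mulVec (g - (∑ i, wt i) • η) - Hd.mulVec d + Hw.mulVec (wHat + wt) ∧
      Hg.mulVec (g - (∑ i, wt i) • η) - Hd.mulVec d + Hw.mulVec (wHat + wt) ≤ fHi) ∧
    (gLo ≤ g - (∑ i, wt i) • η ∧ g - (∑ i, wt i) • η ≤ gHi) ∧
    (Rd ≤ -((∑ i, wt i) • η) ∧ -((∑ i, wt i) • η) ≤ Ru)

theorem SCED_aux {E : Type*} {n : ℕ} [AddCommGroup E] [Module ℝ E] (F : E → (Fin n → ℝ))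
    (hF : ∀ x y : E, ∀ a b : ℝ, a + b = 1 → F (a • x + b • y) = a • F x + b • F y)
    (lo hi : Fin n → ℝ) : Convex ℝ {x | lo ≤ F x ∧ F x ≤ hi} := by
  intro x hx y hy a b ha hb hab
  have h := convex_Icc (𝕜 := ℝ) lo hi (x := F x) hx (y := F y) hy ha hb hab
  rw [← hF x y a b hab] at h
  exact h

/-- Invariant Solution: for the scenario-based SCED constraints, if
`V ⊆ S` and `S ⊆ convexHull ℝ V`, then the set of decision pairs `(g, η)` feasible for
every scenario in `S` equals the set feasible for every scenario in `V`. -/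
theorem sced_convexHull_compression_invariant
    {nf ng nd nw : ℕ}
    (Hg : Matrix (Fin nf) (Fin ng) ℝ) (Hd : Matrix (Fin nf) (Fin nd) ℝ)
    (Hw : Matrix (Fin nf) (Fin nw) ℝ)
    (d : Fin nd → ℝ) (wHat : Fin nw → ℝ)
    (fLo fHi : Fin nf → ℝ) (gLo gHi : Fin ng → ℝ) (Rd Ru : Fin ng → ℝ)
    (S V : Finset (Fin nw → ℝ)) (hVS : V ⊆ S)
    (hhull : (S : Set (Fin nw → ℝ)) ⊆ convexHull ℝ (V : Set (Fin nw → ℝ))) :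
    {p : (Fin ng → ℝ) × (Fin ng → ℝ) |
        ∀ wt ∈ S, SCEDSat Hg Hd Hw d wHat fLo fHi gLo gHi Rd Ru p.1 p.2 wt} =
      {p : (Fin ng → ℝ) × (Fin ng → ℝ) |
        ∀ wt ∈ V, SCEDSat Hg Hd Hw d wHat fLo fHi gLo gHi Rd Ru p.1 p.2 wt} := by
  ext ⟨g, η⟩
  simp only [Set.mem_ofPred_eq]
  refine ⟨fun h wt hwt => h wt (hVS hwt), fun h wt hwt => ?_⟩
  have hsum : ∀ x y : Fin nw → ℝ, ∀ a b : ℝ,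
      (∑ i, (a • x + b • y) i) = a * (∑ i, x i) + b * (∑ i, y i) := by
    intro x y a b
    simp [Finset.sum_add_distrib, Finset.mul_sum]
  have h3 : ∀ x y : Fin nw → ℝ, ∀ a b : ℝ, a + b = 1 →
      -((∑ i, (a • x + b • y) i) • η)
        = a • (-((∑ i, x i) • η)) + b • (-((∑ i, y i) • η)) := by
    intro x y a b hab
    rw [hsum]
    module
  have h2 : ∀ x y : Fin nw → ℝ, ∀ a b : ℝ, a + b = 1 →
      g - (∑ i, (a • x + b • y) i) • η
        = a • (g - (∑ i, x i) • η) + b • (g - (∑ i, y i) • η) := by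
    intro x y a b hab
    obtain rfl : b = 1 - a := by linarith
    rw [hsum]
    module
  have h1 : ∀ x y : Fin nw → ℝ, ∀ a b : ℝ, a + b = 1 →
      Hg.mulVec (g - (∑ i, (a • x + b • y) i) • η) - Hd.mulVec d
          + Hw.mulVec (wHat + (a • x + b • y))
        = a • (Hg.mulVec (g - (∑ i, x i) • η) - Hd.mulVec d + Hw.mulVec (wHat + x))
          + b • (Hg.mulVec (g - (∑ i, y i) • η) - Hd.mulVec d + Hw.mulVec (wHat + y)) := by
    intro x y a b hab
    rw [h2 x y a b hab]
    obtain rfl : b = 1 - a := by linarith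
    simp only [Matrix.mulVec_add, Matrix.mulVec_smul]
    module
  have hc := (SCED_aux (fun w : Fin nw → ℝ => Hg.mulVec (g - (∑ i, w i) • η) - Hd.mulVec d
    + Hw.mulVec (wHat + w)) h1 fLo fHi).inter
    ((SCED_aux (fun w : Fin nw → ℝ => g - (∑ i, w i) • η) h2 gLo gHi).inter (SCED_aux (fun w : Fin nw → ℝ => -((∑ i, w i) • η)) h3 Rd Ru))
  exact convexHull_min (fun x hx => h x hx) hc (hhull hwt)
end

section
/- Let S ⊆ ℝ^{n_w} be a finite nonempty scenario set and let V ⊆ S satisfy S ⊆ convexHull ℝ V. Let X be a decision set, for each x ∈ X let w ↦ f(x, w) = A(x) w + b(x) be affine from ℝ^{n_w} to ℝ^k, let l, u ∈ ℝ^k, write R(T) = {x ∈ X : for every w ∈ T, l ≤ f(x, w) ≤ u componentwise}, and let c : X → ℝ be any objective function. Then the infimum of c over R(S) equals the infimum of c over R(V), and the set of minimizers of c over R(S) equals the set of minimizers of c over R(V). -/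
/-- The feasible region of the scenario problem: decisions `x ∈ X` such that for every
scenario `w ∈ T` the affine-in-scenario constraint values `A x w + b x` lie between `l`
and `u` componentwise. -/
def scenarioRegion {X : Type*} {nw k : ℕ}
    (A : X → ((Fin nw → ℝ) →ₗ[ℝ] (Fin k → ℝ))) (b : X → Fin k → ℝ)
    (l u : Fin k → ℝ) (T : Finset (Fin nw → ℝ)) : Set X :=
  {x | ∀ w ∈ T, l ≤ A x w + b x ∧ A x w + b x ≤ u}

/-- under convex hull compression (`V ⊆ S`, `S ⊆ convexHull ℝ V`) the
optimal cost of the scenario problem and its set of minimizers are both invariant. -/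
theorem convexHull_compression_optimum_invariant
    {X : Type*} {nw k : ℕ}
    (S V : Finset (Fin nw → ℝ)) (hS : S.Nonempty) (hVS : V ⊆ S)
    (hhull : (S : Set (Fin nw → ℝ)) ⊆ convexHull ℝ (V : Set (Fin nw → ℝ)))
    (A : X → ((Fin nw → ℝ) →ₗ[ℝ] (Fin k → ℝ))) (b : X → Fin k → ℝ)
    (l u : Fin k → ℝ) (c : X → ℝ) :
    sInf (c '' scenarioRegion A b l u S) = sInf (c '' scenarioRegion A b l u V) ∧
      {x | x ∈ scenarioRegion A b l u S ∧ ∀ y ∈ scenarioRegion A b l u S, c x ≤ c y} =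
        {x | x ∈ scenarioRegion A b l u V ∧ ∀ y ∈ scenarioRegion A b l u V, c x ≤ c y} := by
  have key : scenarioRegion A b l u S = scenarioRegion A b l u V := by
    ext x
    constructor
    · intro h w hw
      exact h w (hVS hw)
    · intro h w hw
      have hc : Convex ℝ {w : Fin nw → ℝ | A x w + b x ∈ Set.Icc l u} := by
        have h1 : Convex ℝ ((fun z => z + b x) ⁻¹' Set.Icc l u) :=
          (convex_Icc l u).translate_preimage_left (b x)
        exact h1.linear_preimage (A x)
      exact convexHull_min (fun v hv => h v hv) hc (hhull hw)
  rw [key]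
  exact ⟨rfl, rfl⟩
end
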